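/- All coefficients of the Harer–Zagier sequence are positive integers: for every integer g ≥ 1 and every integer k with 0 ≤ k ≤ g − 1, there exists a positive natural number n such that b(g,k) = n. -/

import Mathlib

open PowerSeries in
/-- The series `artanh x - x`. -/
noncomputable def hzS : ℚ⟦X⟧ :=
  PowerSeries.mk fun n => if n % 2 = 1 ∧ 3 ≤ n then (1 : ℚ) / n else 0

/-- Rationals with odd denominator. -/
def hzR : Subring ℚ where
  carrier := {q | ∃ d : ℕ, Odd d ∧ ∃ z : ℤ, q * d = z}
  mul_mem' := by
    rintro a b ⟨d, hd, z, hz⟩ ⟨e, he, w, hw⟩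
    exact ⟨d * e, hd.mul he, z * w, by push_cast; rw [← hz, ← hw]; ring⟩
  one_mem' := ⟨1, odd_one, 1, by simp⟩
  add_mem' := by
    rintro a b ⟨d, hd, z, hz⟩ ⟨e, he, w, hw⟩
    exact ⟨d * e, hd.mul he, z * e + w * d, by push_cast; rw [← hz, ← hw]; ring⟩
  zero_mem' := ⟨1, odd_one, 0, by simp⟩
  neg_mem' := by
    rintro a ⟨d, hd, z, hz⟩
    exact ⟨d, hd, -z, by push_cast; rw [← hz]; ring⟩

lemma hzS_coeff_mem (n : ℕ) : PowerSeries.coeff n hzS ∈ hzR := by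
  rw [hzS, PowerSeries.coeff_mk]
  split_ifs with h
  · refine ⟨n, Nat.odd_iff.2 h.1, 1, ?_⟩
    have : (n : ℚ) ≠ 0 := by
      have : n ≠ 0 := by omega
      exact_mod_cast this
    field_simp
    simp
  · exact hzR.zero_mem

lemma hzS_pow_coeff_mem (j n : ℕ) : PowerSeries.coeff n (hzS ^ j) ∈ hzR := by
  induction j generalizing n with
  | zero =>
    rw [pow_zero, PowerSeries.coeff_one]
    split_ifs
    · exact hzR.one_mem
    · exact hzR.zero_mem
  | succ j ih =>
    rw [pow_succ, PowerSeries.coeff_mul]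
    exact hzR.sum_mem fun p _ => hzR.mul_mem (ih _) (hzS_coeff_mem _)

lemma hzS_pow_coeff_zero (j n : ℕ) (h : n < 3 * j) : PowerSeries.coeff n (hzS ^ j) = 0 := by
  induction j generalizing n with
  | zero => omega
  | succ j ih =>
    rw [pow_succ, PowerSeries.coeff_mul]
    refine Finset.sum_eq_zero fun p hp => ?_
    rw [Finset.HasAntidiagonal.mem_antidiagonal] at hp
    by_cases h1 : p.1 < 3 * j
    · rw [ih _ h1, zero_mul]
    · have : PowerSeries.coeff p.2 hzS = 0 := by
        rw [hzS, PowerSeries.coeff_mk, if_neg]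
        omega
      rw [this, mul_zero]

open PowerSeries in
lemma hzS_deriv : (PowerSeries.derivative ℚ) hzS = X ^ 2 * (PowerSeries.derivative ℚ) hzS + X ^ 2 := by
  ext n
  rw [map_add, PowerSeries.coeff_X_pow_mul', PowerSeries.coeff_X_pow]
  simp only [PowerSeries.coeff_derivative, hzS,
    PowerSeries.coeff_mk]
  have key : ∀ n : ℕ, (if (n + 1) % 2 = 1 ∧ 3 ≤ n + 1 then (1 : ℚ) / ((n + 1 : ℕ) : ℚ) else 0)
      * ((n : ℚ) + 1) = if n % 2 = 0 ∧ 2 ≤ n then 1 else 0 := by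
    intro n
    have : (n : ℚ) + 1 ≠ 0 := by positivity
    by_cases h : n % 2 = 0 ∧ 2 ≤ n
    · rw [if_pos h, if_pos (by omega)]; push_cast; field_simp
    · rw [if_neg h, if_neg (by omega)]; simp
  rw [key n, key (n - 2)]
  by_cases h2 : n = 2
  · subst h2; simp
  · rw [if_neg h2, add_zero]
    by_cases h : n % 2 = 0 ∧ 2 ≤ n
    · rw [if_pos h, if_pos h.2, if_pos (by omega)]
    · rw [if_neg h]
      split_ifs <;> first | rfl | omega

open PowerSeries in
lemma hz_rec (m j : ℕ) :
    ((m : ℚ) + 3) * coeff (m + 3) (hzS ^ (j + 1))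
      = ((m : ℚ) + 1) * coeff (m + 1) (hzS ^ (j + 1)) + ((j : ℚ) + 1) * coeff m (hzS ^ j) := by
  have h1 : (PowerSeries.derivative ℚ) (hzS ^ (j + 1))
      = X ^ 2 * (PowerSeries.derivative ℚ) (hzS ^ (j + 1)) + X ^ 2 * (C ((j : ℚ) + 1) * hzS ^ j) := by
    have e : (PowerSeries.derivative ℚ) (hzS ^ (j + 1))
      = C ((j : ℚ) + 1) * hzS ^ j * (PowerSeries.derivative ℚ) hzS := by
      rw [Derivation.leibniz_pow]
      simp [nsmul_eq_mul]
      ring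
    rw [e]
    conv_lhs => rw [hzS_deriv]
    ring
  have h2 := congrArg (coeff (m + 2)) h1
  rw [map_add, coeff_X_pow_mul, coeff_X_pow_mul] at h2
  simp only [coeff_derivative, coeff_C_mul] at h2
  rw [show m + 2 + 1 = m + 3 by ring] at h2
  push_cast at h2
  linear_combination h2

lemma hz_two_pow (k : ℕ) : (2 : ℚ) ^ k / ((k + 1).factorial : ℚ) ∈ hzR := by
  have hne : (k + 1).factorial ≠ 0 := Nat.factorial_ne_zero _
  obtain ⟨e, d, hd, h⟩ := Nat.exists_eq_two_pow_mul_odd hne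
  have he : e ≤ k := by
    have h1 := Nat.emultiplicity_two_factorial_lt (n := k + 1) (by omega)
    have h2 : (e : ℕ∞) ≤ emultiplicity 2 (k + 1).factorial :=
      le_emultiplicity_of_pow_dvd ⟨d, h⟩
    have h3 := lt_of_le_of_lt h2 h1
    have : e < k + 1 := by exact_mod_cast h3
    omega
  refine ⟨d, hd, 2 ^ (k - e), ?_⟩
  have hd0 : (d : ℚ) ≠ 0 := by
    have : d ≠ 0 := by rintro rfl; simp at hd
    exact_mod_cast this
  rw [h]
  push_cast
  have : (2 : ℚ) ^ k = 2 ^ (k - e) * 2 ^ e := by rw [← pow_add]; congr 1; omega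
  rw [this]
  field_simp

lemma hz_combine (q : ℚ) (h : q ∈ hzR) (e : ℕ) (w : ℤ) (hw : q * 2 ^ e = w) :
    ∃ z : ℤ, q = z := by
  obtain ⟨d, hd, z, hz⟩ := h
  have hc : IsCoprime (d : ℤ) ((2 ^ e : ℕ) : ℤ) :=
    Nat.isCoprime_iff_coprime.2 (Nat.Coprime.pow_right _ (Nat.coprime_two_right.2 hd))
  obtain ⟨u, v, huv⟩ := hc
  refine ⟨u * z + v * w, ?_⟩
  have huv' : (u : ℚ) * d + v * 2 ^ e = 1 := by exact_mod_cast huv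
  push_cast
  rw [← hz, ← hw]
  linear_combination (-q) * huv'

/-- Numbers `a (g+1) k`: scaled counts of permutations. -/
def hzA : ℕ → ℕ → ℕ
  | 0, 0 => 2
  | 0, _ + 1 => 0
  | g + 1, 0 => (2 * (g + 1) + 2) * (2 * (g + 1) + 1) * hzA g 0
  | g + 1, k + 1 => (2 * (g + 1) + (k + 1) + 2) * (2 * (g + 1) + (k + 1) + 1) *
      (hzA g (k + 1) + hzA g k)

lemma hz_cat (m : ℕ) : ((m : ℚ) + 2) * catalan (m + 1) = 2 * (2 * m + 1) * catalan m := by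
  have h1 := succ_mul_catalan_eq_centralBinom m
  have h2 := succ_mul_catalan_eq_centralBinom (m + 1)
  have h3 := Nat.succ_mul_centralBinom_succ m
  have h1' : ((m : ℚ) + 1) * catalan m = m.centralBinom := by exact_mod_cast h1
  have h2' : ((m : ℚ) + 1 + 1) * catalan (m + 1) = (m + 1).centralBinom := by exact_mod_cast h2
  have h3' : ((m : ℚ) + 1) * (m + 1).centralBinom = 2 * (2 * m + 1) * m.centralBinom := by
    exact_mod_cast h3
  have : (m : ℚ) + 1 ≠ 0 := by positivity
  apply mul_left_cancel₀ this
  rw [← h1', ← h2'] at h3'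
  linear_combination h3'

/-- All Harer–Zagier coefficients `b g k` for `1 ≤ g`, `0 ≤ k ≤ g - 1` are
positive integers. -/
theorem harer_zagier_coeffs_positive_integers
    (b : ℕ → ℤ → ℚ)
    (hb1 : b 1 0 = 1)
    (hb0 : ∀ g : ℕ, 1 ≤ g → ∀ k : ℤ, (k < 0 ∨ (g : ℤ) - 1 < k) → b g k = 0)
    (hrec : ∀ g : ℕ, 1 ≤ g → ∀ k : ℤ,
      (4 * (g : ℚ) + 2 * (k : ℚ) + 6) * b (g + 1) k =
        (4 * (g : ℚ) + 2 * (k : ℚ) + 1) * (4 * (g : ℚ) + 2 * (k : ℚ) + 3) *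
          ((4 * (g : ℚ) + 2 * (k : ℚ) + 2) * b g k
            + 4 * (4 * (g : ℚ) + 2 * (k : ℚ) - 1) * b g (k - 1))) :
    ∀ g : ℕ, 1 ≤ g → ∀ k : ℤ, 0 ≤ k → k ≤ (g : ℤ) - 1 →
      ∃ n : ℕ, 0 < n ∧ b g k = (n : ℚ) := by
  -- natural-number form of the recurrence
  have hr0 : ∀ g : ℕ, (4 * (g : ℚ) + 10) * b (g + 2) 0 =
      (4 * (g : ℚ) + 5) * (4 * g + 7) * ((4 * g + 6) * b (g + 1) 0) := by
    intro g
    have h := hrec (g + 1) (by omega) 0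
    rw [hb0 (g + 1) (by omega) (0 - 1) (by left; norm_num)] at h
    push_cast at h
    linear_combination h
  have hrs : ∀ g k : ℕ, (4 * (g : ℚ) + 2 * k + 12) * b (g + 2) ((k + 1 : ℕ) : ℤ) =
      (4 * (g : ℚ) + 2 * k + 7) * (4 * g + 2 * k + 9) *
        ((4 * g + 2 * k + 8) * b (g + 1) ((k + 1 : ℕ) : ℤ)
          + 4 * (4 * g + 2 * k + 5) * b (g + 1) (k : ℤ)) := by
    intro g k
    have h := hrec (g + 1) (by omega) ((k + 1 : ℕ) : ℤ)
    rw [show (((k + 1 : ℕ) : ℤ) - 1) = (k : ℤ) by push_cast; ring] at h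
    push_cast at h ⊢
    linear_combination h
  have hbase : ∀ k : ℕ, b 1 ((k + 1 : ℕ) : ℤ) = 0 := fun k =>
    hb0 1 le_rfl _ (by right; push_cast; omega)
  -- positivity
  have hnn : ∀ g k : ℕ, 0 ≤ b (g + 1) (k : ℤ) ∧ (k ≤ g → 0 < b (g + 1) (k : ℤ)) := by
    intro g
    induction g with
    | zero =>
      intro k
      cases k with
      | zero => simp [hb1]
      | succ k => rw [zero_add, hbase]; simp
    | succ g ih =>
      intro k
      cases k with
      | zero =>
        have h := hr0 g
        have hp := (ih 0).2 (by omega)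
        rw [Nat.cast_zero] at *
        have hp2 : 0 < (4 * (g : ℚ) + 10) * b (g + 2) 0 := by rw [h]; positivity
        have := pos_of_mul_pos_right hp2 (by positivity)
        exact ⟨this.le, fun _ => this⟩
      | succ k =>
        have h := hrs g k
        have h1 := (ih (k + 1)).1
        have h2 := (ih k).1
        constructor
        · have hp2 : 0 ≤ (4 * (g : ℚ) + 2 * k + 12) * b (g + 2) ((k + 1 : ℕ) : ℤ) := by
            rw [h]; positivity
          exact nonneg_of_mul_nonneg_right hp2 (by positivity)
        · intro hk
          have h3 := (ih k).2 (by omega)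
          have hp2 : 0 < (4 * (g : ℚ) + 2 * k + 12) * b (g + 2) ((k + 1 : ℕ) : ℤ) := by
            rw [h]; positivity
          exact pos_of_mul_pos_right hp2 (by positivity)
  -- away from 2
  have hodd : ∀ g k : ℕ, b (g + 1) (k : ℤ) * 4 ^ (g + 1)
      = catalan (2 * g + 2 + k) * hzA g k := by
    intro g
    induction g with
    | zero =>
      intro k
      cases k with
      | zero => simp [hb1, hzA, catalan_two]; norm_num
      | succ k => rw [zero_add, hbase]; simp [hzA]
    | succ g ih =>
      intro k
      cases k with
      | zero =>
        have h := hr0 g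
        have i0 := ih 0
        have c1 := hz_cat (2 * g + 2)
        have c2 := hz_cat (2 * g + 3)
        rw [show 2 * (g + 1) + 2 + 0 = 2 * g + 3 + 1 by ring, hzA]
        rw [show 2 * g + 2 + 0 = 2 * g + 2 by ring] at i0
        rw [show 2 * g + 2 + 1 = 2 * g + 3 by ring] at c1
        push_cast at *
        have n1 : (4 * (g : ℚ) + 10) ≠ 0 := by positivity
        apply mul_left_cancel₀ n1
        rw [pow_succ, show g + 1 + 1 = g + 2 by ring]
        linear_combination 4 * 4 ^ (g + 1) * h + 4 * (4 * (g : ℚ) + 5) * (4 * g + 7) * (4 * g + 6) * i0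
          - 2 * (2 * ((g : ℚ) + 1) + 2) * (2 * (g + 1) + 1) * hzA g 0 * c2
          - 4 * (4 * g + 7) * (2 * ((g : ℚ) + 1) + 1) * hzA g 0 * c1
      | succ k =>
        have h := hrs g k
        have i0 := ih k
        have i1 := ih (k + 1)
        have c0 := hz_cat (2 * g + 2 + k)
        have c1 := hz_cat (2 * g + 2 + k + 1)
        have c2 := hz_cat (2 * g + 2 + k + 2)
        rw [show 2 * (g + 1) + 2 + (k + 1) = 2 * g + 2 + k + 2 + 1 by ring, hzA]
        rw [show 2 * g + 2 + (k + 1) = 2 * g + 2 + k + 1 by ring] at i1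
        rw [show 2 * g + 2 + k + 1 + 1 = 2 * g + 2 + k + 2 by ring] at c1
        push_cast at *
        have n1 : (4 * (g : ℚ) + 2 * k + 12) ≠ 0 := by positivity
        apply mul_left_cancel₀ n1
        rw [pow_succ, show g + 1 + 1 = g + 2 by ring]
        linear_combination 4 * 4 ^ (g + 1) * h
          + 4 * (4 * (g : ℚ) + 2 * k + 7) * (4 * g + 2 * k + 9) * (4 * g + 2 * k + 8) * i1
          + 16 * (4 * (g : ℚ) + 2 * k + 7) * (4 * g + 2 * k + 9) * (4 * g + 2 * k + 5) * i0
          - 2 * (2 * (g : ℚ) + k + 5) * (2 * g + k + 4) * (hzA g (k + 1) + hzA g k) * c2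
          - 4 * (4 * g + 2 * k + 9) * (2 * (g : ℚ) + k + 4) * (hzA g (k + 1) + hzA g k) * c1
          - 8 * (4 * g + 2 * k + 9) * (4 * g + 2 * k + 7) * hzA g k * c0
  -- closed form
  have hcl : ∀ g k : ℕ, b (g + 1) (k : ℤ) = ((2 * (2 * g + 2 + k) - 1).doubleFactorial : ℚ) *
      (2 ^ k / ((k + 1).factorial : ℚ)) * PowerSeries.coeff (2 * g + 2 + k + 1) (hzS ^ (k + 1)) := by
    intro g
    induction g with
    | zero =>
      intro k
      cases k with
      | zero => simp [hb1, hzS, Nat.doubleFactorial]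
      | succ k => rw [zero_add, hbase, hzS_pow_coeff_zero _ _ (by omega), mul_zero]
    | succ g ih =>
      intro k
      cases k with
      | zero =>
        have h := hr0 g
        have i0 := ih 0
        have r := hz_rec (2 * g + 2) 0
        rw [pow_zero, PowerSeries.coeff_one, if_neg (by omega)] at r
        rw [show 2 * (g + 1) + 2 + 0 + 1 = 2 * g + 2 + 3 by ring,
          show 2 * (2 * (g + 1) + 2 + 0) - 1 = (4 * g + 3) + 2 + 2 by omega,
          Nat.doubleFactorial_add_two, Nat.doubleFactorial_add_two]
        rw [show 2 * g + 2 + 0 + 1 = 2 * g + 2 + 1 by ring,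
          show 2 * (2 * g + 2 + 0) - 1 = 4 * g + 3 by omega] at i0
        push_cast at *
        rw [i0] at h
        have n1 : (4 * (g : ℚ) + 10) ≠ 0 := by positivity
        apply mul_left_cancel₀ n1
        rw [show g + 1 + 1 = g + 2 by ring, h]
        simp only [zero_add, Nat.factorial_one, Nat.cast_one, pow_zero, div_one] at *
        linear_combination (-2) * (4 * (g : ℚ) + 5) * (4 * g + 7) * (4 * g + 3).doubleFactorial * r
      | succ k =>
        have h := hrs g k
        have i0 := ih k
        have i1 := ih (k + 1)
        have r := hz_rec (2 * g + 2 + k + 1) (k + 1)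
        rw [show 2 * (g + 1) + 2 + (k + 1) + 1 = 2 * g + 2 + k + 1 + 3 by ring,
          show 2 * (2 * (g + 1) + 2 + (k + 1)) - 1 = (4 * g + 2 * k + 3) + 2 + 2 + 2 by omega,
          Nat.doubleFactorial_add_two, Nat.doubleFactorial_add_two, Nat.doubleFactorial_add_two,
          Nat.factorial_succ (k + 1)]
        rw [show 2 * (2 * g + 2 + k) - 1 = 4 * g + 2 * k + 3 by omega] at i0
        rw [show 2 * g + 2 + (k + 1) + 1 = 2 * g + 2 + k + 1 + 1 by ring,
          show 2 * (2 * g + 2 + (k + 1)) - 1 = (4 * g + 2 * k + 3) + 2 by omega,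
          Nat.doubleFactorial_add_two, Nat.factorial_succ (k + 1)] at i1
        push_cast at *
        rw [i0, i1] at h
        have n1 : (4 * (g : ℚ) + 2 * k + 12) ≠ 0 := by positivity
        have n2 : ((k + 1).factorial : ℚ) ≠ 0 := by positivity
        have n3 : ((k : ℚ) + 1 + 1) ≠ 0 := by positivity
        apply mul_left_cancel₀ n1
        rw [show g + 1 + 1 = g + 2 by ring, h]
        generalize PowerSeries.coeff (2 * g + 2 + k + 1 + 3) (hzS ^ (k + 1 + 1)) = x at *
        generalize PowerSeries.coeff (2 * g + 2 + k + 1 + 1) (hzS ^ (k + 1 + 1)) = y at *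
        generalize PowerSeries.coeff (2 * g + 2 + k + 1) (hzS ^ (k + 1)) = z at *
        generalize ((4 * g + 2 * k + 3).doubleFactorial : ℚ) = D at *
        generalize ((k + 1).factorial : ℚ) = f at *
        rw [pow_succ]
        field_simp
        linear_combination (-4) * (4 * (g : ℚ) + 2 * k + 7) * (4 * g + 2 * k + 9) * (4 * g + 2 * k + 5) * D * r
  -- conclusion
  intro g hg k hk0 hk
  obtain ⟨g, rfl⟩ : ∃ g', g = g' + 1 := ⟨g - 1, by omega⟩
  lift k to ℕ using hk0
  have hpos := (hnn g k).2 (by push_cast at hk; omega)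
  have hmem : b (g + 1) (k : ℤ) ∈ hzR := by
    rw [hcl]
    exact hzR.mul_mem (hzR.mul_mem (natCast_mem hzR _) (hz_two_pow k)) (hzS_pow_coeff_mem _ _)
  obtain ⟨z, hz⟩ := hz_combine _ hmem (2 * (g + 1)) (catalan (2 * g + 2 + k) * hzA g k) (by
    rw [pow_mul]; norm_num; exact hodd g k)
  rw [hz] at hpos
  have hzpos : 0 < z := by exact_mod_cast hpos
  lift z to ℕ using hzpos.le
  exact ⟨z, by exact_mod_cast hzpos, by rw [hz]; simp⟩
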